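/- arXiv:1009.2152 — 4 statements merged into one kernel-verified Lean document; each statement's English description precedes it below -/
import Mathlib

section
/- Let μ₁, μ₂, μ₃ > 0 with μ₁ + μ₂ + μ₃ = 1, and let m = min(μ₁, μ₂, μ₃). For (x₁, x₂, x₃) ∈ D = { x ∈ ℝ³ : x₁, x₂, x₃ ≥ 0 and x₁+x₂ > 0, x₂+x₃ > 0, x₃+x₁ > 0 }, define F(x₁, x₂, x₃) = (x₁x₂ + x₂x₃ + x₃x₁ + (min(x₁, x₂, x₃))²) / ((x₁+x₂)/μ₁ + (x₂+x₃)/μ₂ + (x₃+x₁)/μ₃)². Then the maximum of F over D exists and equals 1/(1/μ₁ + 1/μ₂ + 1/μ₃)² if 1/μ₁, 1/μ₂, 1/μ₃ satisfy the triangle inequality, and equals μ₁μ₂μ₃/(4(1−m)) otherwise. -/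
/-- Three positive reals satisfy the triangle inequality. -/
def TriangleIneq (a b c : ℝ) : Prop := a + b > c ∧ b + c > a ∧ a + c > b

/-- The domain D of the optimization problem. -/
def Dset : Set (ℝ × ℝ × ℝ) :=
  {x | 0 ≤ x.1 ∧ 0 ≤ x.2.1 ∧ 0 ≤ x.2.2 ∧
       0 < x.1 + x.2.1 ∧ 0 < x.2.1 + x.2.2 ∧ 0 < x.2.2 + x.1}

/-- The objective function F of Proposition 2.5. -/
noncomputable def Ffun (μ₁ μ₂ μ₃ x₁ x₂ x₃ : ℝ) : ℝ :=
  (x₁ * x₂ + x₂ * x₃ + x₃ * x₁ + (min x₁ (min x₂ x₃)) ^ 2) /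
    ((x₁ + x₂) / μ₁ + (x₂ + x₃) / μ₂ + (x₃ + x₁) / μ₃) ^ 2

/-- Core bound when `z ≤ x ≤ y`. -/
lemma core_bound (a b c K x y z : ℝ) (ha : 0 < a) (hb : 0 < b) (hc : 0 < c)
    (hz : 0 ≤ z) (hzx : z ≤ x) (hxy : x ≤ y)
    (H1 : c ≤ a + b → K ≤ (a + b + c) ^ 2) (H2 : a + b ≤ c → K ≤ 4 * (c * (a + b))) :
    (x * y + y * z + z * x + z ^ 2) * K ≤ ((x + y) * a + (y + z) * b + (z + x) * c) ^ 2 := by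
  obtain ⟨p, hp⟩ : ∃ p, p = x + z := ⟨_, rfl⟩
  obtain ⟨q, hq⟩ : ∃ q, q = y + z := ⟨_, rfl⟩
  have hp0 : 0 ≤ p := by linarith
  have hpq : p ≤ q := by linarith
  have hq0 : 0 ≤ q := by linarith
  have hN : x * y + y * z + z * x + z ^ 2 = p * q := by rw [hp, hq]; ring
  have hL : c * p + (a + b) * q ≤ (x + y) * a + (y + z) * b + (z + x) * c := by
    rw [hp, hq]; nlinarith [mul_nonneg ha.le (sub_nonneg.2 hzx)]
  have hL0 : 0 ≤ c * p + (a + b) * q := by positivity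
  have hL2 := pow_le_pow_left₀ hL0 hL 2
  have hpq0 : 0 ≤ p * q := mul_nonneg hp0 hq0
  rw [hN]
  refine le_trans ?_ hL2
  rcases le_total c (a + b) with h | h
  · have h1 := mul_le_mul_of_nonneg_left (H1 h) hpq0
    have h2 : c ^ 2 * p ≤ (a + b) ^ 2 * q :=
      mul_le_mul (pow_le_pow_left₀ hc.le h 2) hpq hp0 (by positivity)
    nlinarith [mul_nonneg (sub_nonneg.2 hpq) (sub_nonneg.2 h2)]
  · have h1 := mul_le_mul_of_nonneg_left (H2 h) hpq0
    nlinarith [sq_nonneg (c * p - (a + b) * q)]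

lemma num_bound (a b c K x y z : ℝ) (ha : 0 < a) (hb : 0 < b) (hc : 0 < c)
    (hx : 0 ≤ x) (hy : 0 ≤ y) (hz : 0 ≤ z)
    (HS : K ≤ (a + b + c) ^ 2)
    (Ha : b + c ≤ a → K ≤ 4 * (a * (b + c)))
    (Hb : a + c ≤ b → K ≤ 4 * (b * (a + c)))
    (Hc : a + b ≤ c → K ≤ 4 * (c * (a + b))) :
    (x * y + y * z + z * x + (min x (min y z)) ^ 2) * K ≤
      ((x + y) * a + (y + z) * b + (z + x) * c) ^ 2 := by
  have Sa : K ≤ (b + c + a) ^ 2 := by convert HS using 2; ring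
  have Sa' : K ≤ (c + b + a) ^ 2 := by convert HS using 2; ring
  have Sb : K ≤ (a + c + b) ^ 2 := by convert HS using 2; ring
  have Sb' : K ≤ (c + a + b) ^ 2 := by convert HS using 2; ring
  have Sc' : K ≤ (b + a + c) ^ 2 := by convert HS using 2; ring
  rcases le_total x y with xy | xy <;> rcases le_total y z with yz | yz <;>
    rcases le_total x z with xz | xz
  · rw [min_eq_left yz, min_eq_left xy]
    have := core_bound b c a K y z x hb hc ha hx xy yz (fun _ => Sa) Ha
    linarith
  · rw [min_eq_left yz, min_eq_left xy]
    have := core_bound b c a K y z x hb hc ha hx xy yz (fun _ => Sa) Ha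
    linarith
  · rw [min_eq_right yz, min_eq_left xz]
    have := core_bound b a c K z y x hb ha hc hx xz yz (fun _ => Sc')
      (fun h => by rw [add_comm b a]; exact Hc (by linarith))
    linarith
  · rw [min_eq_right yz, min_eq_right xz]
    have := core_bound a b c K x y z ha hb hc hz xz xy (fun _ => HS) Hc
    linarith
  · rw [min_eq_left yz, min_eq_right xy]
    have := core_bound c b a K x z y hc hb ha hy xy xz (fun _ => Sa')
      (fun h => by rw [add_comm c b]; exact Ha (by linarith))
    linarith
  · rw [min_eq_left yz, min_eq_right xy]
    have := core_bound c a b K z x y hc ha hb hy yz xz (fun _ => Sb')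
      (fun h => by rw [add_comm c a]; exact Hb (by linarith))
    linarith
  · rw [min_eq_right yz, min_eq_right (yz.trans xy)]
    have := core_bound a c b K y x z ha hc hb hz yz xy (fun _ => Sb) Hb
    linarith
  · rw [min_eq_right yz, min_eq_right (yz.trans xy)]
    have := core_bound a c b K y x z ha hc hb hz yz xy (fun _ => Sb) Hb
    linarith

/-- Packaging: the value `1/K` is the maximum as soon as it is attained and `K` is small enough. -/
lemma greatest_of (μ₁ μ₂ μ₃ a b c K x y z : ℝ) (ha : 0 < a) (hb : 0 < b) (hc : 0 < c)
    (ea : a = 1 / μ₁) (eb : b = 1 / μ₂) (ec : c = 1 / μ₃) (hK : 0 < K)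
    (HS : K ≤ (a + b + c) ^ 2)
    (Ha : b + c ≤ a → K ≤ 4 * (a * (b + c)))
    (Hb : a + c ≤ b → K ≤ 4 * (b * (a + c)))
    (Hc : a + b ≤ c → K ≤ 4 * (c * (a + b)))
    (hx : 0 < x) (hy : 0 < y) (hz : 0 < z)
    (hatt : (x * y + y * z + z * x + (min x (min y z)) ^ 2) * K =
      ((x + y) * a + (y + z) * b + (z + x) * c) ^ 2) :
    IsGreatest ((fun x : ℝ × ℝ × ℝ => Ffun μ₁ μ₂ μ₃ x.1 x.2.1 x.2.2) '' Dset) (1 / K) := by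
  have hF : ∀ x y z : ℝ, Ffun μ₁ μ₂ μ₃ x y z =
      (x * y + y * z + z * x + (min x (min y z)) ^ 2) /
        ((x + y) * a + (y + z) * b + (z + x) * c) ^ 2 := by
    intro x y z
    rw [Ffun, ea, eb, ec]
    simp only [div_eq_mul_one_div (x + y) μ₁, div_eq_mul_one_div (y + z) μ₂,
      div_eq_mul_one_div (z + x) μ₃]
  constructor
  · refine ⟨(x, y, z), ⟨hx.le, hy.le, hz.le, by positivity, by positivity, by positivity⟩, ?_⟩
    simp only [hF]
    rw [div_eq_div_iff (by positivity) hK.ne']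
    linarith
  · rintro _ ⟨⟨x, y, z⟩, ⟨hx, hy, hz, hxy, hyz, hzx⟩, rfl⟩
    simp only at hx hy hz hxy hyz hzx
    simp only [hF]
    rw [div_le_div_iff₀ (by positivity) hK]
    have := num_bound a b c K x y z ha hb hc hx hy hz HS Ha Hb Hc
    linarith

/-- the maximum of F over D exists and is given by Eq. (15). -/
theorem stmt7 (μ₁ μ₂ μ₃ : ℝ) (h₁ : 0 < μ₁) (h₂ : 0 < μ₂) (h₃ : 0 < μ₃)
    (hsum : μ₁ + μ₂ + μ₃ = 1) (m : ℝ) (hm : m = min μ₁ (min μ₂ μ₃)) :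
    (TriangleIneq (1 / μ₁) (1 / μ₂) (1 / μ₃) →
      IsGreatest ((fun x : ℝ × ℝ × ℝ => Ffun μ₁ μ₂ μ₃ x.1 x.2.1 x.2.2) '' Dset)
        (1 / (1 / μ₁ + 1 / μ₂ + 1 / μ₃) ^ 2)) ∧
    (¬ TriangleIneq (1 / μ₁) (1 / μ₂) (1 / μ₃) →
      IsGreatest ((fun x : ℝ × ℝ × ℝ => Ffun μ₁ μ₂ μ₃ x.1 x.2.1 x.2.2) '' Dset)
        (μ₁ * μ₂ * μ₃ / (4 * (1 - m)))) := by
  have ha : 0 < 1 / μ₁ := by positivity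
  have hb : 0 < 1 / μ₂ := by positivity
  have hc : 0 < 1 / μ₃ := by positivity
  obtain ⟨a, ea⟩ : ∃ a, a = 1 / μ₁ := ⟨_, rfl⟩
  obtain ⟨b, eb⟩ : ∃ b, b = 1 / μ₂ := ⟨_, rfl⟩
  obtain ⟨c, ec⟩ : ∃ c, c = 1 / μ₃ := ⟨_, rfl⟩
  have ia : μ₁ = 1 / a := by rw [ea]; field_simp
  have ib : μ₂ = 1 / b := by rw [eb]; field_simp
  have ic : μ₃ = 1 / c := by rw [ec]; field_simp
  rw [← ea, ← eb, ← ec]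
  rw [← ea] at ha
  rw [← eb] at hb
  rw [← ec] at hc
  constructor
  · rintro ⟨t1, t2, t3⟩
    refine greatest_of μ₁ μ₂ μ₃ a b c _ 1 1 1 ha hb hc ea eb ec (by positivity) le_rfl
      (fun h => by linarith) (fun h => by linarith) (fun h => by linarith)
      one_pos one_pos one_pos ?_
    simp only [min_self]
    ring
  · intro hT
    have hcase : a + b ≤ c ∨ b + c ≤ a ∨ a + c ≤ b := by
      by_contra hcon
      push Not at hcon
      exact hT hcon
    rcases hcase with h | h | h
    · have l1 : μ₃ ≤ μ₁ := by
        rw [ia, ic]; exact one_div_le_one_div_of_le ha (by linarith)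
      have l2 : μ₃ ≤ μ₂ := by
        rw [ib, ic]; exact one_div_le_one_div_of_le hb (by linarith)
      have hm' : 1 - m = μ₁ + μ₂ := by
        rw [hm, min_eq_right l2, min_eq_right l1]; linarith
      have hv : μ₁ * μ₂ * μ₃ / (4 * (1 - m)) = 1 / (4 * (c * (a + b))) := by
        rw [hm', ia, ib, ic]; field_simp; ring
      rw [hv]
      refine greatest_of μ₁ μ₂ μ₃ a b c _ ((a + b) / 2) (c - (a + b) / 2) ((a + b) / 2)
        ha hb hc ea eb ec (by positivity) (by nlinarith [sq_nonneg (a + b - c)])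
        (fun h => by linarith) (fun h => by linarith) (fun h => le_rfl)
        (by linarith) (by linarith) (by linarith) ?_
      rw [min_eq_right (by linarith : (a + b) / 2 ≤ c - (a + b) / 2), min_self]
      ring
    · have l1 : μ₁ ≤ μ₂ := by
        rw [ia, ib]; exact one_div_le_one_div_of_le hb (by linarith)
      have l2 : μ₁ ≤ μ₃ := by
        rw [ia, ic]; exact one_div_le_one_div_of_le hc (by linarith)
      have hm' : 1 - m = μ₂ + μ₃ := by
        rw [hm, min_eq_left (le_min l1 l2)]; linarith
      have hv : μ₁ * μ₂ * μ₃ / (4 * (1 - m)) = 1 / (4 * (a * (b + c))) := by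
        rw [hm', ia, ib, ic]; field_simp; ring
      rw [hv]
      refine greatest_of μ₁ μ₂ μ₃ a b c _ ((b + c) / 2) ((b + c) / 2) (a - (b + c) / 2)
        ha hb hc ea eb ec (by positivity) (by nlinarith [sq_nonneg (b + c - a)])
        (fun h => le_rfl) (fun h => by linarith) (fun h => by linarith)
        (by linarith) (by linarith) (by linarith) ?_
      rw [min_eq_left (by linarith : (b + c) / 2 ≤ a - (b + c) / 2), min_self]
      ring
    · have l1 : μ₂ ≤ μ₁ := by
        rw [ia, ib]; exact one_div_le_one_div_of_le ha (by linarith)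
      have l2 : μ₂ ≤ μ₃ := by
        rw [ib, ic]; exact one_div_le_one_div_of_le hc (by linarith)
      have hm' : 1 - m = μ₁ + μ₃ := by
        rw [hm, min_eq_left l2, min_eq_right l1]; linarith
      have hv : μ₁ * μ₂ * μ₃ / (4 * (1 - m)) = 1 / (4 * (b * (a + c))) := by
        rw [hm', ia, ib, ic]; field_simp; ring
      rw [hv]
      refine greatest_of μ₁ μ₂ μ₃ a b c _ (b - (a + c) / 2) ((a + c) / 2) ((a + c) / 2)
        ha hb hc ea eb ec (by positivity) (by nlinarith [sq_nonneg (a + c - b)])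
        (fun h => by linarith) (fun h => le_rfl) (fun h => by linarith)
        (by linarith) (by linarith) (by linarith) ?_
      rw [min_self, min_eq_right (by linarith : (a + c) / 2 ≤ b - (a + c) / 2)]
      ring
end

section
/- Let μ₁, μ₂, μ₃ > 0 with μ₁ + μ₂ + μ₃ = 1. For (x₁, x₂, x₃) ∈ D = { x ∈ ℝ³ : x₁, x₂, x₃ ≥ 0 and x₁+x₂ > 0, x₂+x₃ > 0, x₃+x₁ > 0 }, define F(x₁, x₂, x₃) = (x₁x₂ + x₂x₃ + x₃x₁ + (min(x₁, x₂, x₃))²) / ((x₁+x₂)/μ₁ + (x₂+x₃)/μ₂ + (x₃+x₁)/μ₃)². The maximum of F over D is attained at the following points: at x₁ = x₂ = x₃ when 1/μ₁, 1/μ₂, 1/μ₃ satisfy the triangle inequality; at x₁ = x₂ = ((1/μ₂ + 1/μ₃)/(2/μ₁ − 1/μ₂ − 1/μ₃)) x₃ when 1/μ₁ ≥ 1/μ₂ + 1/μ₃; at x₂ = x₃ = ((1/μ₃ + 1/μ₁)/(2/μ₂ − 1/μ₃ − 1/μ₁)) x₁ when 1/μ₂ ≥ 1/μ₃ + 1/μ₁;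 and at x₃ = x₁ = ((1/μ₁ + 1/μ₂)/(2/μ₃ − 1/μ₁ − 1/μ₂)) x₂ when 1/μ₃ ≥ 1/μ₁ + 1/μ₂. -/
/-- The numerator is the product of two pair sums, the third one being the largest. -/
lemma num_cases (x y z : ℝ) :
    (x * y + y * z + z * x + (min x (min y z)) ^ 2 = (x + y) * (z + x) ∧ x + y ≤ y + z ∧ z + x ≤ y + z) ∨
    (x * y + y * z + z * x + (min x (min y z)) ^ 2 = (x + y) * (y + z) ∧ x + y ≤ z + x ∧ y + z ≤ z + x) ∨
    (x * y + y * z + z * x + (min x (min y z)) ^ 2 = (y + z) * (z + x) ∧ y + z ≤ x + y ∧ z + x ≤ x + y) := by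
  rcases le_total y z with h | h
  · rw [min_eq_left h]
    rcases le_total x y with h' | h'
    · rw [min_eq_left h']; left; exact ⟨by ring, by linarith, by linarith⟩
    · rw [min_eq_right h']; right; left; exact ⟨by ring, by linarith, by linarith⟩
  · rw [min_eq_right h]
    rcases le_total x z with h' | h'
    · rw [min_eq_left h']; left; exact ⟨by ring, by linarith, by linarith⟩
    · rw [min_eq_right h']; right; right; exact ⟨by ring, by linarith, by linarith⟩

lemma tri_sorted (a b c X Y Z : ℝ) (ha : 0 < a) (hb : 0 < b) (hc : 0 < c)
    (h : b ≤ a + c) (hY : 0 < Y) (hYZ : Y ≤ Z) (hZX : Z ≤ X) :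
    Y * Z * (a + b + c) ^ 2 ≤ (a * X + b * Y + c * Z) ^ 2 := by
  have h1 : (a + c) * Z + b * Y ≤ a * X + b * Y + c * Z := by nlinarith
  have h2 : 0 ≤ (a + c) * Z + b * Y := by
    have : 0 < Z := by linarith
    positivity
  have h3 : b ^ 2 * Y ≤ (a + c) ^ 2 * Z := by
    have : b ^ 2 ≤ (a + c) ^ 2 := by nlinarith
    exact mul_le_mul this hYZ hY.le (by positivity)
  have h4 := mul_nonneg (sub_nonneg.2 hYZ) (sub_nonneg.2 h3)
  have h5 := pow_le_pow_left₀ h2 h1 2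
  nlinarith

lemma tri_max (a b c X Y Z : ℝ) (ha : 0 < a) (hb : 0 < b) (hc : 0 < c)
    (h : b ≤ a + c) (h' : c ≤ a + b) (hY : 0 < Y) (hZ : 0 < Z) (hYX : Y ≤ X) (hZX : Z ≤ X) :
    Y * Z * (a + b + c) ^ 2 ≤ (a * X + b * Y + c * Z) ^ 2 := by
  rcases le_total Y Z with h0 | h0
  · exact tri_sorted a b c X Y Z ha hb hc h hY h0 hZX
  · have := tri_sorted a c b X Z Y ha hc hb h' hZ h0 hYX
    nlinarith

lemma amgm (p q U V L : ℝ) (hp : 0 < p) (hq : 0 < q) (hU : 0 < U) (hV : 0 < V)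
    (h : p * U + q * V ≤ L) : U * V * (4 * p * q) ≤ L ^ 2 := by
  have h5 := pow_le_pow_left₀ (by positivity) h 2
  nlinarith [sq_nonneg (p * U - q * V)]

lemma tri_bound (a b c x y z : ℝ) (ha : 0 < a) (hb : 0 < b) (hc : 0 < c)
    (h : b ≤ a + c) (h' : c ≤ a + b) (h'' : a ≤ b + c)
    (hX : 0 < x + y) (hY : 0 < y + z) (hZ : 0 < z + x) :
    (x * y + y * z + z * x + (min x (min y z)) ^ 2) * (a + b + c) ^ 2
      ≤ (a * (x + y) + b * (y + z) + c * (z + x)) ^ 2 := by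
  rcases num_cases x y z with ⟨e, h1, h2⟩ | ⟨e, h1, h2⟩ | ⟨e, h1, h2⟩ <;> rw [e]
  · convert tri_max b a c _ _ _ hb ha hc h'' (by linarith) hX hZ h1 h2 using 1 <;> ring
  · convert tri_max c a b _ _ _ hc ha hb (by linarith) (by linarith) hX hY h1 h2 using 1 <;> ring
  · exact tri_max a b c _ _ _ ha hb hc h h' hY hZ h1 h2

lemma big_bound (a b c x y z : ℝ) (ha : 0 < a) (hb : 0 < b) (hc : 0 < c)
    (hX : 0 < x + y) (hY : 0 < y + z) (hZ : 0 < z + x) :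
    (x * y + y * z + z * x + (min x (min y z)) ^ 2) * (4 * a * (b + c))
      ≤ (a * (x + y) + b * (y + z) + c * (z + x)) ^ 2 := by
  rcases num_cases x y z with ⟨e, h1, h2⟩ | ⟨e, h1, h2⟩ | ⟨e, h1, h2⟩ <;> rw [e]
  · exact amgm _ _ _ _ _ ha (by linarith) hX hZ (by nlinarith)
  · exact amgm _ _ _ _ _ ha (by linarith) hX hY (by nlinarith)
  · rcases le_total (y + z) (z + x) with h0 | h0
    · rw [mul_comm (y + z)]
      exact amgm _ _ _ _ _ ha (by linarith) hZ hY (by nlinarith)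
    · exact amgm _ _ _ _ _ ha (by linarith) hY hZ (by nlinarith)

lemma Ffun_eq (μ₁ μ₂ μ₃ x y z : ℝ) : Ffun μ₁ μ₂ μ₃ x y z =
    (x * y + y * z + z * x + (min x (min y z)) ^ 2) /
    ((1 / μ₁) * (x + y) + (1 / μ₂) * (y + z) + (1 / μ₃) * (z + x)) ^ 2 := by
  unfold Ffun
  congr 2
  ring

lemma Ffun_cyc (μ₁ μ₂ μ₃ x y z : ℝ) : Ffun μ₁ μ₂ μ₃ x y z = Ffun μ₂ μ₃ μ₁ y z x := by
  unfold Ffun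
  have : min x (min y z) = min y (min z x) := by
    rw [min_comm x, min_assoc]
  rw [this]
  congr 1 <;> ring

lemma big_case (μ₁ μ₂ μ₃ : ℝ) (h₁ : 0 < μ₁) (h₂ : 0 < μ₂) (h₃ : 0 < μ₃)
    (h : 1 / μ₁ ≥ 1 / μ₂ + 1 / μ₃) (x y z : ℝ) (hX : 0 < x + y) (hz : 0 ≤ z)
    (e1 : x = (1 / μ₂ + 1 / μ₃) / (2 / μ₁ - 1 / μ₂ - 1 / μ₃) * z)
    (e2 : y = (1 / μ₂ + 1 / μ₃) / (2 / μ₁ - 1 / μ₂ - 1 / μ₃) * z)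
    (u v w : ℝ) (hu : 0 < u + v) (hv : 0 < v + w) (hw : 0 < w + u) :
    Ffun μ₁ μ₂ μ₃ u v w ≤ Ffun μ₁ μ₂ μ₃ x y z := by
  rw [Ffun_eq, Ffun_eq]
  have e : 2 / μ₁ = 2 * (1 / μ₁) := by ring
  rw [e] at e1 e2
  have ha : 0 < 1 / μ₁ := by positivity
  have hb : 0 < 1 / μ₂ := by positivity
  have hc : 0 < 1 / μ₃ := by positivity
  generalize 1 / μ₁ = a at *
  generalize 1 / μ₂ = b at *
  generalize 1 / μ₃ = c at *
  have hd : 0 < 2 * a - b - c := by linarith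
  have hz' : 0 < z := by
    rcases hz.eq_or_lt with h0 | h0
    · rw [e1, e2, ← h0] at hX; simp at hX
    · exact h0
  obtain ⟨k, rfl⟩ : ∃ k, z = (2 * a - b - c) * k := ⟨z / (2 * a - b - c), by field_simp⟩
  have hk : 0 < k := pos_of_mul_pos_right hz' hd.le
  have e3 : (b + c) / (2 * a - b - c) * ((2 * a - b - c) * k) = (b + c) * k := by field_simp
  rw [e3] at e1 e2
  subst e1 e2
  have hm : (b + c) * k ≤ (2 * a - b - c) * k := by
    apply mul_le_mul_of_nonneg_right _ hk.le; linarith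
  rw [min_eq_left hm, min_self]
  have hs : 0 < b + c := by linarith
  have e4 : ((b + c) * k * ((b + c) * k) + (b + c) * k * ((2 * a - b - c) * k)
      + (2 * a - b - c) * k * ((b + c) * k) + ((b + c) * k) ^ 2) /
      (a * ((b + c) * k + (b + c) * k) + b * ((b + c) * k + (2 * a - b - c) * k)
        + c * ((2 * a - b - c) * k + (b + c) * k)) ^ 2 = 1 / (4 * a * (b + c)) := by
    have n1 : (b + c) * k * ((b + c) * k) + (b + c) * k * ((2 * a - b - c) * k)
      + (2 * a - b - c) * k * ((b + c) * k) + ((b + c) * k) ^ 2 = 4 * a * (b + c) * k ^ 2 := by ring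
    have n2 : a * ((b + c) * k + (b + c) * k) + b * ((b + c) * k + (2 * a - b - c) * k)
        + c * ((2 * a - b - c) * k + (b + c) * k) = 4 * a * (b + c) * k := by ring
    rw [n1, n2]
    field_simp
  rw [e4, div_le_div_iff₀ (by positivity) (by positivity), one_mul]
  exact big_bound a b c u v w ha hb hc hu hv hw

/-- the maximum of F over D is attained at the points of Eq. (16). -/
theorem stmt8 (μ₁ μ₂ μ₃ : ℝ) (h₁ : 0 < μ₁) (h₂ : 0 < μ₂) (h₃ : 0 < μ₃)
    (hsum : μ₁ + μ₂ + μ₃ = 1) :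
    (TriangleIneq (1 / μ₁) (1 / μ₂) (1 / μ₃) →
      ∀ x ∈ Dset, x.1 = x.2.1 ∧ x.2.1 = x.2.2 →
        ∀ y ∈ Dset, Ffun μ₁ μ₂ μ₃ y.1 y.2.1 y.2.2 ≤ Ffun μ₁ μ₂ μ₃ x.1 x.2.1 x.2.2) ∧
    (1 / μ₁ ≥ 1 / μ₂ + 1 / μ₃ →
      ∀ x ∈ Dset,
        (x.1 = (1 / μ₂ + 1 / μ₃) / (2 / μ₁ - 1 / μ₂ - 1 / μ₃) * x.2.2 ∧
         x.2.1 = (1 / μ₂ + 1 / μ₃) / (2 / μ₁ - 1 / μ₂ - 1 / μ₃) * x.2.2) →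
        ∀ y ∈ Dset, Ffun μ₁ μ₂ μ₃ y.1 y.2.1 y.2.2 ≤ Ffun μ₁ μ₂ μ₃ x.1 x.2.1 x.2.2) ∧
    (1 / μ₂ ≥ 1 / μ₃ + 1 / μ₁ →
      ∀ x ∈ Dset,
        (x.2.1 = (1 / μ₃ + 1 / μ₁) / (2 / μ₂ - 1 / μ₃ - 1 / μ₁) * x.1 ∧
         x.2.2 = (1 / μ₃ + 1 / μ₁) / (2 / μ₂ - 1 / μ₃ - 1 / μ₁) * x.1) →
        ∀ y ∈ Dset, Ffun μ₁ μ₂ μ₃ y.1 y.2.1 y.2.2 ≤ Ffun μ₁ μ₂ μ₃ x.1 x.2.1 x.2.2) ∧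
    (1 / μ₃ ≥ 1 / μ₁ + 1 / μ₂ →
      ∀ x ∈ Dset,
        (x.2.2 = (1 / μ₁ + 1 / μ₂) / (2 / μ₃ - 1 / μ₁ - 1 / μ₂) * x.2.1 ∧
         x.1 = (1 / μ₁ + 1 / μ₂) / (2 / μ₃ - 1 / μ₁ - 1 / μ₂) * x.2.1) →
        ∀ y ∈ Dset, Ffun μ₁ μ₂ μ₃ y.1 y.2.1 y.2.2 ≤ Ffun μ₁ μ₂ μ₃ x.1 x.2.1 x.2.2) := by
  refine ⟨?_, ?_, ?_, ?_⟩
  · rintro ⟨t1, t2, t3⟩ ⟨x, y, z⟩ ⟨-, -, -, hX, -, -⟩ ⟨e1, e2⟩ ⟨u, v, w⟩ ⟨-, -, -, hu, hv, hw⟩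
    simp only at *
    subst e1 e2
    rw [Ffun_eq, Ffun_eq]
    have ha : 0 < 1 / μ₁ := by positivity
    have hb : 0 < 1 / μ₂ := by positivity
    have hc : 0 < 1 / μ₃ := by positivity
    generalize 1 / μ₁ = a at *
    generalize 1 / μ₂ = b at *
    generalize 1 / μ₃ = c at *
    have hx : 0 < x := by linarith
    rw [min_self, min_self]
    have e4 : (x * x + x * x + x * x + x ^ 2) / (a * (x + x) + b * (x + x) + c * (x + x)) ^ 2
        = 1 / (a + b + c) ^ 2 := by
      rw [div_eq_div_iff (by positivity) (by positivity)]
      ring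
    rw [e4, div_le_div_iff₀ (by positivity) (by positivity), one_mul]
    exact tri_bound a b c u v w ha hb hc (by linarith) (by linarith) (by linarith) hu hv hw
  · rintro h ⟨x, y, z⟩ ⟨-, -, hz, hX, -, -⟩ ⟨e1, e2⟩ ⟨u, v, w⟩ ⟨-, -, -, hu, hv, hw⟩
    exact big_case μ₁ μ₂ μ₃ h₁ h₂ h₃ h x y z hX hz e1 e2 u v w hu hv hw
  · rintro h ⟨x, y, z⟩ ⟨hx, -, -, -, hY, -⟩ ⟨e1, e2⟩ ⟨u, v, w⟩ ⟨-, -, -, hu, hv, hw⟩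
    rw [Ffun_cyc, Ffun_cyc μ₁]
    exact big_case μ₂ μ₃ μ₁ h₂ h₃ h₁ h y z x hY hx e1 e2 v w u hv hw hu
  · rintro h ⟨x, y, z⟩ ⟨-, hy, -, -, -, hZ⟩ ⟨e1, e2⟩ ⟨u, v, w⟩ ⟨-, -, -, hu, hv, hw⟩
    rw [← Ffun_cyc μ₃, ← Ffun_cyc μ₃]
    exact big_case μ₃ μ₁ μ₂ h₃ h₁ h₂ h z x y hZ hy e1 e2 w u v hw hu hv
end

section
/- Let μ₁, μ₂, μ₃ > 0 with μ₁ + μ₂ + μ₃ = 1. For (x₁, x₂, x₃) with x₁, x₂, x₃ ≥ 0, x₁+x₂ > 0, x₂+x₃ > 0, x₃+x₁ > 0 and the ordering constraint x₁ ≤ x₂ ≤ x₃, define F(x₁, x₂, x₃) = (x₁x₂ + x₂x₃ + x₃x₁ + x₁²) / ((x₁+x₂)/μ₁ + (x₂+x₃)/μ₂ + (x₃+x₁)/μ₃)². Then the maximum of F over this restricted set equals μ₁μ₂μ₃/(4(1−μ₁)) if 1/μ₁ ≥ 1/μ₂ + 1/μ₃, and equals 1/(1/μ₁ + 1/μ₂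 + 1/μ₃)² if 1/μ₁ < 1/μ₂ + 1/μ₃; it is attained at x₁ = x₂ = ((1/μ₂ + 1/μ₃)/(2/μ₁ − 1/μ₂ − 1/μ₃)) x₃ in the first case, and at x₁ = x₂ = x₃ in the second case. -/
/-- The domain D of the optimization problem restricted by the ordering x₁ ≤ x₂ ≤ x₃. -/
def DsetOrd : Set (ℝ × ℝ × ℝ) :=
  {x | 0 ≤ x.1 ∧ 0 ≤ x.2.1 ∧ 0 ≤ x.2.2 ∧
       0 < x.1 + x.2.1 ∧ 0 < x.2.1 + x.2.2 ∧ 0 < x.2.2 + x.1 ∧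
       x.1 ≤ x.2.1 ∧ x.2.1 ≤ x.2.2}

/-- The objective function F on the ordered region, where min(x₁,x₂,x₃) = x₁. -/
noncomputable def FfunOrd (μ₁ μ₂ μ₃ x₁ x₂ x₃ : ℝ) : ℝ :=
  (x₁ * x₂ + x₂ * x₃ + x₃ * x₁ + x₁ ^ 2) /
    ((x₁ + x₂) / μ₁ + (x₂ + x₃) / μ₂ + (x₃ + x₁) / μ₃) ^ 2

lemma FfunOrd_eq (μ₁ μ₂ μ₃ x y z : ℝ) :
    FfunOrd μ₁ μ₂ μ₃ x y z = ((x + y) * (z + x)) /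
      ((1 / μ₁) * (x + y) + (1 / μ₂) * (y + z) + (1 / μ₃) * (z + x)) ^ 2 := by
  unfold FfunOrd
  congr 1
  · ring
  · ring

lemma bound_aux {a b c x y z : ℝ} (ha : 0 < a) (hb : 0 < b) (hc : 0 < c)
    (hp : 0 < x + y) (hq : 0 < z + x) (hxy : x ≤ y) :
    ((x + y) * (z + x)) / (a * (x + y) + b * (y + z) + c * (z + x)) ^ 2 ≤
      ((x + y) * (z + x)) / (a * (x + y) + (b + c) * (z + x)) ^ 2 := by
  have h1 : a * (x + y) + (b + c) * (z + x) ≤ a * (x + y) + b * (y + z) + c * (z + x) := by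
    nlinarith
  gcongr

/-- Lemma 2.11: the maximum of F over the ordered region. -/
theorem stmt9 (μ₁ μ₂ μ₃ : ℝ) (h₁ : 0 < μ₁) (h₂ : 0 < μ₂) (h₃ : 0 < μ₃)
    (hsum : μ₁ + μ₂ + μ₃ = 1) :
    (1 / μ₁ ≥ 1 / μ₂ + 1 / μ₃ →
      IsGreatest ((fun x : ℝ × ℝ × ℝ => FfunOrd μ₁ μ₂ μ₃ x.1 x.2.1 x.2.2) '' DsetOrd)
          (μ₁ * μ₂ * μ₃ / (4 * (1 - μ₁))) ∧
      ∀ x ∈ DsetOrd,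
        (x.1 = (1 / μ₂ + 1 / μ₃) / (2 / μ₁ - 1 / μ₂ - 1 / μ₃) * x.2.2 ∧
         x.2.1 = (1 / μ₂ + 1 / μ₃) / (2 / μ₁ - 1 / μ₂ - 1 / μ₃) * x.2.2) →
        FfunOrd μ₁ μ₂ μ₃ x.1 x.2.1 x.2.2 = μ₁ * μ₂ * μ₃ / (4 * (1 - μ₁))) ∧
    (1 / μ₁ < 1 / μ₂ + 1 / μ₃ →
      IsGreatest ((fun x : ℝ × ℝ × ℝ => FfunOrd μ₁ μ₂ μ₃ x.1 x.2.1 x.2.2) '' DsetOrd)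
          (1 / (1 / μ₁ + 1 / μ₂ + 1 / μ₃) ^ 2) ∧
      ∀ x ∈ DsetOrd, (x.1 = x.2.1 ∧ x.2.1 = x.2.2) →
        FfunOrd μ₁ μ₂ μ₃ x.1 x.2.1 x.2.2 = 1 / (1 / μ₁ + 1 / μ₂ + 1 / μ₃) ^ 2) := by
  set a := 1 / μ₁ with ha_def
  set b := 1 / μ₂ with hb_def
  set c := 1 / μ₃ with hc_def
  have ha : 0 < a := by positivity
  have hb : 0 < b := by positivity
  have hc : 0 < c := by positivity
  have h2a : 2 / μ₁ = 2 * a := by rw [ha_def]; ring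
  have hval : μ₁ * μ₂ * μ₃ / (4 * (1 - μ₁)) = 1 / (4 * a * (b + c)) := by
    have h : 1 - μ₁ = μ₂ + μ₃ := by linarith
    rw [h, ha_def, hb_def, hc_def]
    field_simp
    try ring
  rw [hval, h2a]
  constructor
  · intro hac
    have hd : 0 < 2 * a - b - c := by linarith
    have key : ∀ x ∈ DsetOrd, (x.1 = (b + c) / (2 * a - b - c) * x.2.2 ∧
         x.2.1 = (b + c) / (2 * a - b - c) * x.2.2) →
        FfunOrd μ₁ μ₂ μ₃ x.1 x.2.1 x.2.2 = 1 / (4 * a * (b + c)) := by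
      rintro ⟨x, y, z⟩ ⟨_, _, hz, hp, _, hq, hxy, hyz⟩ ⟨e1, e2⟩
      simp only at *
      rw [FfunOrd_eq, ← ha_def, ← hb_def, ← hc_def]
      obtain ⟨t, ht⟩ : ∃ t, z = (2 * a - b - c) * t := ⟨z / (2 * a - b - c), by field_simp⟩
      have hx : x = (b + c) * t := by rw [e1, ht]; field_simp
      have hy : y = (b + c) * t := by rw [e2, ht]; field_simp
      have ht0 : t ≠ 0 := by
        rintro rfl
        simp [hx, hy] at hp
      rw [hx, hy, ht]
      have e3 : a * ((b + c) * t + (b + c) * t) + b * ((b + c) * t + (2 * a - b - c) * t) +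
        c * ((2 * a - b - c) * t + (b + c) * t) = 4 * a * (b + c) * t := by ring
      rw [e3, div_eq_div_iff (by positivity) (by positivity)]
      ring
    refine ⟨⟨?_, ?_⟩, key⟩
    · have hm : (b + c, b + c, 2 * a - b - c) ∈ DsetOrd := by
        refine ⟨?_, ?_, ?_, ?_, ?_, ?_, ?_, ?_⟩ <;> simp only <;> linarith
      refine ⟨_, hm, key _ hm ⟨?_, ?_⟩⟩ <;> simp only <;> field_simp
    · rintro _ ⟨⟨x, y, z⟩, ⟨_, _, hz, hp, _, hq, hxy, hyz⟩, rfl⟩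
      simp only at *
      rw [FfunOrd_eq, ← ha_def, ← hb_def, ← hc_def]
      refine (bound_aux ha hb hc hp hq hxy).trans ?_
      rw [div_le_div_iff₀ (by positivity) (by positivity)]
      nlinarith [sq_nonneg (a * (x + y) - (b + c) * (z + x))]
  · intro hac
    have key : ∀ x ∈ DsetOrd, (x.1 = x.2.1 ∧ x.2.1 = x.2.2) →
        FfunOrd μ₁ μ₂ μ₃ x.1 x.2.1 x.2.2 = 1 / (a + b + c) ^ 2 := by
      rintro ⟨x, y, z⟩ ⟨_, _, hz, hp, _, hq, hxy, hyz⟩ ⟨e1, e2⟩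
      simp only at *
      subst e1 e2
      rw [FfunOrd_eq, ← ha_def, ← hb_def, ← hc_def, div_eq_div_iff (by positivity) (by positivity)]
      ring
    refine ⟨⟨?_, ?_⟩, key⟩
    · have hm : ((1 : ℝ), (1 : ℝ), (1 : ℝ)) ∈ DsetOrd := by
        refine ⟨?_, ?_, ?_, ?_, ?_, ?_, ?_, ?_⟩ <;> norm_num
      exact ⟨_, hm, key _ hm ⟨rfl, rfl⟩⟩
    · rintro _ ⟨⟨x, y, z⟩, ⟨_, _, hz, hp, _, hq, hxy, hyz⟩, rfl⟩
      simp only at *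
      rw [FfunOrd_eq, ← ha_def, ← hb_def, ← hc_def]
      refine (bound_aux ha hb hc hp hq hxy).trans ?_
      rw [div_le_div_iff₀ (by positivity) (by positivity)]
      have hpq : x + y ≤ z + x := by linarith
      have hs : a ^ 2 * (x + y) ≤ (b + c) ^ 2 * (z + x) := by gcongr
      nlinarith [mul_nonneg (sub_nonneg.2 hpq) (sub_nonneg.2 hs)]
end

section
/- Let μ₁, μ₂, μ₃ > 0 with μ₁ + μ₂ + μ₃ = 1, and suppose 1/μ₁, 1/μ₂, 1/μ₃ satisfy the triangle inequality. Then 4μ₁μ₂μ₃ ≥ (μ₁μ₂ + μ₁μ₃ + μ₂μ₃)² ≥ 3μ₁μ₂μ₃. -/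
/-- Remark 2.7: if μ₁ + μ₂ + μ₃ = 1 and 1/μ₁, 1/μ₂, 1/μ₃ satisfy the
triangle inequality, then 4μ₁μ₂μ₃ ≥ (μ₁μ₂ + μ₁μ₃ + μ₂μ₃)² ≥ 3μ₁μ₂μ₃. -/
theorem stmt17 (μ₁ μ₂ μ₃ : ℝ) (h₁ : 0 < μ₁) (h₂ : 0 < μ₂) (h₃ : 0 < μ₃)
    (hsum : μ₁ + μ₂ + μ₃ = 1)
    (htri : TriangleIneq (1 / μ₁) (1 / μ₂) (1 / μ₃)) :
    4 * (μ₁ * μ₂ * μ₃) ≥ (μ₁ * μ₂ + μ₁ * μ₃ + μ₂ * μ₃) ^ 2 ∧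
    (μ₁ * μ₂ + μ₁ * μ₃ + μ₂ * μ₃) ^ 2 ≥ 3 * (μ₁ * μ₂ * μ₃) := by
  obtain ⟨t1, t2, t3⟩ := htri
  have hp : 0 < μ₁ * μ₂ * μ₃ := by positivity
  have e1 : 1 / μ₁ * (μ₁ * μ₂ * μ₃) = μ₂ * μ₃ := by field_simp
  have e2 : 1 / μ₂ * (μ₁ * μ₂ * μ₃) = μ₁ * μ₃ := by field_simp
  have e3 : 1 / μ₃ * (μ₁ * μ₂ * μ₃) = μ₁ * μ₂ := by field_simp
  have k1 := mul_lt_mul_of_pos_right t1 hp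
  have k2 := mul_lt_mul_of_pos_right t2 hp
  have k3 := mul_lt_mul_of_pos_right t3 hp
  rw [add_mul, e1, e2, e3] at k1
  rw [add_mul, e1, e2, e3] at k2
  rw [add_mul, e1, e2, e3] at k3
  have key : μ₁ * μ₂ * μ₃ = (μ₁ * μ₂) * (μ₁ * μ₃) + (μ₁ * μ₂) * (μ₂ * μ₃)
      + (μ₁ * μ₃) * (μ₂ * μ₃) := by
    linear_combination (-(μ₁ * μ₂ * μ₃)) * hsum
  have hx : 0 < μ₂ * μ₃ := by positivity
  have hy : 0 < μ₁ * μ₃ := by positivity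
  have hz : 0 < μ₁ * μ₂ := by positivity
  rw [key]
  generalize μ₂ * μ₃ = x at *
  generalize μ₁ * μ₃ = y at *
  generalize μ₁ * μ₂ = z at *
  constructor
  · nlinarith [mul_pos hz (sub_pos.2 k1), mul_pos hx (sub_pos.2 k2), mul_pos hy (sub_pos.2 k3)]
  · nlinarith [sq_nonneg (x - y), sq_nonneg (y - z), sq_nonneg (x - z)]
end
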